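/- (Triangular inequality for merging size.) Let P1, P2, P3 be paradigms over finite nonempty index sets. Then msize(P1, P2) + msize(P2, P3) ≥ msize(P1, P3). -/

import Mathlib

/-- The size of a paradigm `P : I → Fin n → α`: the sum over columns of the metric
diameter of the column set `P[i] = {P s i : s ∈ I}`. -/
noncomputable def psize {α : Type*} [PseudoMetricSpace α] {I : Type*} {n : ℕ}
    (P : I → Fin n → α) : ℝ :=
  ∑ i : Fin n, Metric.diam (Set.range fun s => P s i)

/-- `Q` is a column-insertion of `P`: there is a strictly monotone map `f` of the columns
of `P` into the columns of `Q` such that `Q` agrees with `P` along `f` and is `null`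
on all other columns. -/
def IsColInsertion {α : Type*} (null : α) {I : Type*} {n m : ℕ}
    (Q : I → Fin m → α) (P : I → Fin n → α) : Prop :=
  ∃ f : Fin n → Fin m, StrictMono f ∧
    (∀ s i, Q s (f i) = P s i) ∧
    ∀ s j, j ∉ Set.range f → Q s j = null

/-- `Q` is a merged paradigm of `P1` and `P2`: its restriction to `I1` is a
column-insertion of `P1` and its restriction to `I2` is a column-insertion of `P2`. -/
def IsMergedParadigm {α : Type*} (null : α) {I1 I2 : Type*} {n1 n2 m : ℕ}
    (P1 : I1 → Fin n1 → α) (P2 : I2 → Fin n2 → α) (Q : I1 ⊕ I2 → Fin m → α) : Prop :=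
  IsColInsertion null (fun s => Q (Sum.inl s)) P1 ∧
  IsColInsertion null (fun s => Q (Sum.inr s)) P2

/-- The merging size `msize(P1, P2)`: the infimum of `size(Q)` over all merged
paradigms `Q` of `P1` and `P2`. -/
noncomputable def msize {α : Type*} [PseudoMetricSpace α] (null : α) {I1 I2 : Type*}
    {n1 n2 : ℕ} (P1 : I1 → Fin n1 → α) (P2 : I2 → Fin n2 → α) : ℝ :=
  sInf {r : ℝ | ∃ (m : ℕ) (Q : I1 ⊕ I2 → Fin m → α),
    IsMergedParadigm null P1 P2 Q ∧ psize Q = r}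

open Classical in
/-- The position of the column `a : Fin m` in an amalgam along `f`. Columns are grouped in blocks of
length `K`; the block of `a` counts the columns `f i` before `a`, and columns in the range of `f`
sit at place `top` of their block. -/
noncomputable def amalgamPos {n m : ℕ} (f : Fin n → Fin m) (K off top : ℕ) (a : Fin m) : ℕ :=
  (Finset.univ.filter fun i => f i < a).card * K + if a ∈ Set.range f then top else off + a

theorem amalgamPos_apply {n m : ℕ} {f : Fin n → Fin m} (hf : StrictMono f) (K off top : ℕ)
    (i : Fin n) : amalgamPos f K off top (f i) = i * K + top := by
  have h : (Finset.univ.filter fun j => f j < f i) = Finset.Iio i := by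
    ext j; simp [hf.lt_iff_lt]
  unfold amalgamPos
  rw [if_pos ⟨i, rfl⟩]
  congr 2
  rw [← Fin.card_Iio i, ← h]

theorem amalgamPos_of_notMem {n m : ℕ} {f : Fin n → Fin m} (K off top : ℕ) {a : Fin m}
    (ha : a ∉ Set.range f) :
    amalgamPos f K off top a = (Finset.univ.filter fun i => f i < a).card * K + (off + a) := by
  unfold amalgamPos
  rw [if_neg ha]

theorem amalgamPos_lt {n m : ℕ} (f : Fin n → Fin m) {K off top : ℕ} (h : off + m ≤ top)
    (hK : top < K) (a : Fin m) : amalgamPos f K off top a < (n + 1) * K := by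
  have hc : (Finset.univ.filter fun i => f i < a).card ≤ n := by
    simpa using Finset.card_filter_le Finset.univ (fun i => f i < a)
  have := Nat.mul_le_mul_right K hc
  unfold amalgamPos
  rw [Nat.succ_mul]
  split_ifs <;> omega

theorem strictMono_amalgamPos {n m : ℕ} (f : Fin n → Fin m) {K off top : ℕ} (h : off + m ≤ top)
    (hK : top < K) : StrictMono (amalgamPos f K off top) := by
  intro a b hab
  have hsub : (Finset.univ.filter fun i => f i < a) ⊆ Finset.univ.filter fun i => f i < b := by
    intro i
    simpa using fun hi => lt_trans hi hab
  have hab' : (a : ℕ) < b := hab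
  unfold amalgamPos
  rcases (Finset.card_le_card hsub).lt_or_eq with hlt | heq
  · have := Nat.mul_le_mul_right K (Nat.succ_le_of_lt hlt)
    rw [Nat.succ_mul] at this
    split_ifs <;> omega
  · have ha : a ∉ Set.range f := by
      rintro ⟨i, rfl⟩
      have hmem : i ∈ Finset.univ.filter fun j => f j < b := by simpa using hab
      rw [← Finset.eq_of_subset_of_card_le hsub heq.ge] at hmem
      simp at hmem
    rw [heq, if_neg ha]
    split_ifs <;> omega

/-- Two strictly monotone maps out of a finite linear order can be amalgamated. -/
theorem exists_strictMono_amalgam {n m m' : ℕ} {f : Fin n → Fin m} {g : Fin n → Fin m'}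
    (hf : StrictMono f) (hg : StrictMono g) :
    ∃ (k : ℕ) (u : Fin m → Fin k) (v : Fin m' → Fin k), StrictMono u ∧ StrictMono v ∧
      (∀ i, u (f i) = v (g i)) ∧ ∀ a b, u a = v b → ∃ i, f i = a ∧ g i = b := by
  set T := m + m'
  have h₁ : 0 + m ≤ T := by omega
  have h₂ : m + m' ≤ T := le_rfl
  have hK : T < T + 1 := T.lt_succ_self
  refine ⟨(n + 1) * (T + 1), fun a => ⟨_, amalgamPos_lt f h₁ hK a⟩,
    fun b => ⟨_, amalgamPos_lt g h₂ hK b⟩, fun _ _ hab => strictMono_amalgamPos f h₁ hK hab,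
    fun _ _ hab => strictMono_amalgamPos g h₂ hK hab, fun i => ?_, fun a b hab => ?_⟩
  · simp only [amalgamPos_apply hf, amalgamPos_apply hg]
  · have key : ∀ {p q r s : ℕ}, r < T + 1 → s < T + 1 → p * (T + 1) + r = q * (T + 1) + s →
        r = s ∧ p = q := by
      intro p q r s hr hs h
      have hpq : p = q := by
        have := congrArg (· / (T + 1)) h
        simpa [Nat.mul_comm _ (T + 1), Nat.mul_add_div, Nat.div_eq_of_lt hr,
          Nat.div_eq_of_lt hs] using this
      subst hpq
      exact ⟨by omega, rfl⟩
    have hab' := congrArg Fin.val hab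
    dsimp only at hab'
    have := a.isLt
    have := b.isLt
    by_cases ha : a ∈ Set.range f <;> by_cases hb : b ∈ Set.range g
    · obtain ⟨i, rfl⟩ := ha
      obtain ⟨j, rfl⟩ := hb
      rw [amalgamPos_apply hf, amalgamPos_apply hg] at hab'
      have hij : i = j := Fin.ext (key hK hK hab').2
      exact ⟨i, rfl, by rw [hij]⟩
    · obtain ⟨i, rfl⟩ := ha
      rw [amalgamPos_apply hf, amalgamPos_of_notMem _ _ _ hb] at hab'
      have := (key (by omega) (by omega) hab').1
      omega
    · obtain ⟨j, rfl⟩ := hb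
      rw [amalgamPos_apply hg, amalgamPos_of_notMem _ _ _ ha] at hab'
      have := (key (by omega) (by omega) hab').1
      omega
    · rw [amalgamPos_of_notMem _ _ _ ha, amalgamPos_of_notMem _ _ _ hb] at hab'
      have := (key (by omega) (by omega) hab').1
      omega

theorem IsColInsertion.trans {α : Type*} {null : α} {I : Type*} {n m k : ℕ}
    {R : I → Fin k → α} {Q : I → Fin m → α} {P : I → Fin n → α}
    (hRQ : IsColInsertion null R Q) (hQP : IsColInsertion null Q P) :
    IsColInsertion null R P := by
  obtain ⟨u, hu, hu₁, hu₂⟩ := hRQ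
  obtain ⟨f, hf, hf₁, hf₂⟩ := hQP
  refine ⟨u ∘ f, hu.comp hf, fun s i => by simp [hu₁, hf₁], fun s j hj => ?_⟩
  by_cases h : j ∈ Set.range u
  · obtain ⟨a, rfl⟩ := h
    rw [hu₁]
    exact hf₂ s a fun ⟨i, hi⟩ => hj ⟨i, by simp [hi]⟩
  · exact hu₂ s j h

theorem isColInsertion_extend {α : Type*} (null : α) {I : Type*} {m k : ℕ} {u : Fin m → Fin k}
    (hu : StrictMono u) (Q : I → Fin m → α) :
    IsColInsertion null (fun s => Function.extend u (Q s) fun _ => null) Q :=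
  ⟨u, hu, fun _ _ => hu.injective.extend_apply _ _ _,
    fun _ j hj => Function.extend_apply' _ _ j hj⟩

theorem psize_extend {α : Type*} [PseudoMetricSpace α] (null : α) {I : Type*} {m k : ℕ}
    {u : Fin m → Fin k} (hu : Function.Injective u) (Q : I → Fin m → α) :
    psize (fun s => Function.extend u (Q s) fun _ => null) = psize Q := by
  refine (Fintype.sum_of_injective u hu _ _ (fun j hj => ?_) fun a => ?_).symm
  · refine Metric.diam_subsingleton ?_
    rintro _ ⟨s, rfl⟩ _ ⟨t, rfl⟩
    simp only [Function.extend_apply' _ _ _ hj]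
  · simp only [hu.extend_apply]

theorem psize_nonneg {α : Type*} [PseudoMetricSpace α] {I : Type*} {n : ℕ}
    (P : I → Fin n → α) : 0 ≤ psize P :=
  Finset.sum_nonneg fun _ _ => Metric.diam_nonneg

theorem exists_isMergedParadigm {α : Type*} (null : α) {I1 I2 : Type*} {n1 n2 : ℕ}
    (P1 : I1 → Fin n1 → α) (P2 : I2 → Fin n2 → α) :
    ∃ (m : ℕ) (Q : I1 ⊕ I2 → Fin m → α), IsMergedParadigm null P1 P2 Q := by
  obtain ⟨k, u, v, hu, hv, -⟩ := exists_strictMono_amalgam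
    (f := (Fin.elim0 : Fin 0 → Fin n1)) (g := (Fin.elim0 : Fin 0 → Fin n2))
    (fun i => i.elim0) (fun i => i.elim0)
  exact ⟨k, Sum.elim (fun s => Function.extend u (P1 s) fun _ => null)
    (fun s => Function.extend v (P2 s) fun _ => null),
    isColInsertion_extend null hu P1, isColInsertion_extend null hv P2⟩

theorem msize_le_psize {α : Type*} [PseudoMetricSpace α] {null : α} {I1 I2 : Type*}
    {n1 n2 m : ℕ} {P1 : I1 → Fin n1 → α} {P2 : I2 → Fin n2 → α} {Q : I1 ⊕ I2 → Fin m → α}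
    (hQ : IsMergedParadigm null P1 P2 Q) : msize null P1 P2 ≤ psize Q :=
  csInf_le ⟨0, by rintro _ ⟨_, Q, -, rfl⟩; exact psize_nonneg Q⟩ ⟨m, Q, hQ, rfl⟩

theorem le_msize {α : Type*} [PseudoMetricSpace α] {null : α} {I1 I2 : Type*}
    {n1 n2 : ℕ} {P1 : I1 → Fin n1 → α} {P2 : I2 → Fin n2 → α} {c : ℝ}
    (h : ∀ (m : ℕ) (Q : I1 ⊕ I2 → Fin m → α), IsMergedParadigm null P1 P2 Q → c ≤ psize Q) :
    c ≤ msize null P1 P2 := by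
  obtain ⟨m, Q, hQ⟩ := exists_isMergedParadigm null P1 P2
  refine le_csInf ⟨_, m, Q, hQ, rfl⟩ ?_
  rintro _ ⟨m, Q, hQ, rfl⟩
  exact h m Q hQ

/-- Triangle inequality for the diameters of unions of finite families, the middle one
nonempty. -/
theorem diam_range_sumElim_le {α : Type*} [PseudoMetricSpace α] {I1 I2 I3 : Type*}
    [Finite I1] [Finite I2] [Nonempty I2] [Finite I3] {x : I1 → α} {y : I2 → α} {z : I3 → α} :
    Metric.diam (Set.range (Sum.elim x z)) ≤
      Metric.diam (Set.range (Sum.elim x y)) + Metric.diam (Set.range (Sum.elim y z)) := by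
  refine (Metric.diam_mono ?_ ((Set.finite_range (Sum.elim x y)).union
    (Set.finite_range (Sum.elim y z))).isBounded).trans (Metric.diam_union' ?_)
  · rw [Set.Sum.elim_range, Set.Sum.elim_range, Set.Sum.elim_range]
    exact Set.union_subset_union Set.subset_union_left Set.subset_union_right
  · obtain ⟨s⟩ := ‹Nonempty I2›
    exact ⟨y s, ⟨Sum.inr s, rfl⟩, ⟨Sum.inl s, rfl⟩⟩

theorem sumElim_column {α A B : Type*} {n : ℕ} (U : A → Fin n → α) (V : B → Fin n → α)
    (i : Fin n) :
    Sum.elim (fun s => U s i) (fun s => V s i) = fun s => Sum.elim U V s i := by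
  funext s
  cases s <;> rfl

theorem psize_sumElim_le {α : Type*} [PseudoMetricSpace α] {I1 I2 I3 : Type*}
    [Finite I1] [Finite I2] [Nonempty I2] [Finite I3] {n : ℕ}
    (X : I1 → Fin n → α) (Y : I2 → Fin n → α) (Z : I3 → Fin n → α) :
    psize (Sum.elim X Z) ≤ psize (Sum.elim X Y) + psize (Sum.elim Y Z) := by
  unfold psize
  rw [← Finset.sum_add_distrib]
  refine Finset.sum_le_sum fun i _ => ?_
  have h := diam_range_sumElim_le (x := fun s => X s i) (y := fun s => Y s i) (z := fun s => Z s i)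
  rwa [sumElim_column, sumElim_column, sumElim_column] at h

theorem exists_isMergedParadigm_psize_le {α : Type*} [PseudoMetricSpace α] {null : α}
    {I1 I2 I3 : Type*} [Finite I1] [Finite I2] [Nonempty I2] [Finite I3] {n1 n2 n3 m m' : ℕ}
    {P1 : I1 → Fin n1 → α} {P2 : I2 → Fin n2 → α} {P3 : I3 → Fin n3 → α}
    {Q : I1 ⊕ I2 → Fin m → α} {R : I2 ⊕ I3 → Fin m' → α}
    (hQ : IsMergedParadigm null P1 P2 Q) (hR : IsMergedParadigm null P2 P3 R) :
    ∃ (k : ℕ) (S : I1 ⊕ I3 → Fin k → α),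
      IsMergedParadigm null P1 P3 S ∧ psize S ≤ psize Q + psize R := by
  obtain ⟨hQ₁, f, hf, hf₁, hf₂⟩ := hQ
  obtain ⟨⟨g, hg, hg₁, hg₂⟩, hR₃⟩ := hR
  obtain ⟨k, u, v, hu, hv, huv, huv'⟩ := exists_strictMono_amalgam hf hg
  let X : I1 → Fin k → α := fun s => Function.extend u (Q (Sum.inl s)) fun _ => null
  let Y : I2 → Fin k → α := fun s => Function.extend u (Q (Sum.inr s)) fun _ => null
  let Y' : I2 → Fin k → α := fun s => Function.extend v (R (Sum.inl s)) fun _ => null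
  let Z : I3 → Fin k → α := fun s => Function.extend v (R (Sum.inr s)) fun _ => null
  have hY : Y = Y' := by
    funext s j
    by_cases h : ∃ a, u a = j <;> by_cases h' : ∃ b, v b = j
    · obtain ⟨a, rfl⟩ := h
      obtain ⟨b, hb⟩ := h'
      obtain ⟨i, rfl, rfl⟩ := huv' a b hb.symm
      simp only [Y, Y', hu.injective.extend_apply]
      rw [huv, hv.injective.extend_apply]
      exact (hf₁ s i).trans (hg₁ s i).symm
    · obtain ⟨a, rfl⟩ := h
      simp only [Y, Y', hu.injective.extend_apply, Function.extend_apply' _ _ _ h']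
      exact hf₂ s a fun ⟨i, hi⟩ => h' ⟨g i, by rw [← huv, hi]⟩
    · obtain ⟨b, rfl⟩ := h'
      simp only [Y, Y', hv.injective.extend_apply, Function.extend_apply' _ _ _ h]
      exact (hg₂ s b fun ⟨i, hi⟩ => h ⟨f i, by rw [huv, hi]⟩).symm
    · simp only [Y, Y', Function.extend_apply' _ _ _ h, Function.extend_apply' _ _ _ h']
  refine ⟨k, Sum.elim X Z, ⟨(isColInsertion_extend null hu _).trans hQ₁,
    (isColInsertion_extend null hv _).trans hR₃⟩, ?_⟩
  have hXY : psize (Sum.elim X Y) = psize Q := by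
    rw [← psize_extend null hu.injective Q]
    congr 1
    funext s
    cases s <;> rfl
  have hYZ : psize (Sum.elim Y Z) = psize R := by
    rw [hY, ← psize_extend null hv.injective R]
    congr 1
    funext s
    cases s <;> rfl
  rw [← hXY, ← hYZ]
  exact psize_sumElim_le X Y Z

/-- **Triangular inequality for merging size.**
`msize(P1, P2) + msize(P2, P3) ≥ msize(P1, P3)`. -/
theorem msize_triangle {α : Type*} [PseudoMetricSpace α] (null : α)
    {I1 I2 I3 : Type*} [Fintype I1] [Nonempty I1] [Fintype I2] [Nonempty I2]
    [Fintype I3] [Nonempty I3] {n1 n2 n3 : ℕ}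
    (P1 : I1 → Fin n1 → α) (P2 : I2 → Fin n2 → α) (P3 : I3 → Fin n3 → α) :
    msize null P1 P3 ≤ msize null P1 P2 + msize null P2 P3 := by
  rw [← sub_le_iff_le_add]
  refine le_msize fun m Q hQ => ?_
  rw [sub_le_comm]
  refine le_msize fun m' R hR => ?_
  obtain ⟨k, S, hS, hle⟩ := exists_isMergedParadigm_psize_le hQ hR
  linarith [msize_le_psize hS]
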